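/- arXiv:1102.3818 — 2 statements merged into one kernel-verified Lean document; each statement's English description precedes it below -/
import Mathlib

section
/- Let n ≥ 2 and let k be an even integer. Let M = (a, b; c, d) ∈ SAV(ℝ⊕ℝ^{n−1}) and let f : H⁺ → Cl_n satisfy f(x) = (conj(cx+d)/‖cx+d‖^{n+1−k}) · f(M<x>) for all x ∈ H⁺. Then g(x) := x_n^{−k} f(x) satisfies g(x) = (conj(cx+d)/‖cx+d‖^{n+1+k}) · g(M<x>) for all x ∈ H⁺. -/
noncomputable section

open scoped symmDiff

/-- An explicit model of the real Clifford algebra `Cl_n` with generators `e 0, …, e (n-1)`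
satisfying `eᵢ eⱼ + eⱼ eᵢ = -2 δᵢⱼ` (the Clifford algebra of the negative definite
quadratic form on `ℝⁿ`): elements are coordinate functions on the canonical basis
`(e_A)_{A ⊆ {0,…,n-1}}`, where `e_A` is the (increasingly ordered) product of the `e i`, `i ∈ A`. -/
def Cl (n : ℕ) : Type := Finset (Fin n) → ℝ

namespace Cl

variable {n : ℕ}

instance : NormedAddCommGroup (Cl n) :=
  inferInstanceAs (NormedAddCommGroup (Finset (Fin n) → ℝ))

instance : NormedSpace ℝ (Cl n) :=
  inferInstanceAs (NormedSpace ℝ (Finset (Fin n) → ℝ))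

/-- The coefficient of `a` at the basis element `e_A`. -/
def coeff (a : Cl n) (A : Finset (Fin n)) : ℝ := a A

/-- The sign occurring in the product `e_A * e_B = mulSign A B • e_{A ∆ B}`,
coming from the relations `eᵢ eⱼ = -eⱼ eᵢ` (i ≠ j) and `eᵢ² = -1`. -/
def mulSign (A B : Finset (Fin n)) : ℝ :=
  (-1 : ℝ) ^ (((A ×ˢ B).filter fun p => p.2 < p.1).card + (A ∩ B).card)

/-- Clifford multiplication. -/
def mul (a b : Cl n) : Cl n := fun C =>
  ∑ A : Finset (Fin n), ∑ B : Finset (Fin n),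
    if A ∆ B = C then mulSign A B * a A * b B else 0

/-- The unit `1` of the Clifford algebra. -/
def one : Cl n := Pi.single ∅ 1

/-- The embedding of the real scalars. -/
def scalar (r : ℝ) : Cl n := Pi.single ∅ r

/-- The generators `e i` (in the paper: `e_1, …, e_n`). -/
def e (i : Fin n) : Cl n := Pi.single {i} 1

/-- Reversion: the anti-automorphism fixing all the `e i`. -/
def reverse (a : Cl n) : Cl n := fun A => (-1 : ℝ) ^ (A.card * (A.card - 1) / 2) * a A

/-- The main involution `′`: the automorphism with `(e i)′ = - e i`. -/
def involute (a : Cl n) : Cl n := fun A => (-1 : ℝ) ^ A.card * a A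

/-- Clifford conjugation: the anti-automorphism with `conj (e i) = - e i`
(the composite of reversion and the main involution). -/
def conj (a : Cl n) : Cl n := fun A => (-1 : ℝ) ^ (A.card * (A.card + 1) / 2) * a A

/-- The norm on `Cl n`: the square root of the sum of the squares of the
coordinates in the standard basis. -/
def norm (a : Cl n) : ℝ := Real.sqrt (∑ A : Finset (Fin n), a A ^ 2)

/-- Invertibility in the Clifford algebra. -/
def IsInvertible (a : Cl n) : Prop := ∃ b, mul a b = one ∧ mul b a = one

/-- The inverse of an invertible Clifford number (junk value `0` otherwise). -/
def inv (a : Cl n) : Cl n :=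
  letI := Classical.propDecidable (IsInvertible a)
  if h : IsInvertible a then h.choose else 0

/-- The paravector `x₀ + x₁ e₁ + ⋯ + xₙ eₙ` attached to `x ∈ ℝ^{n+1}`. -/
def para (x : Fin (n + 1) → ℝ) : Cl n :=
  scalar (x 0) + ∑ i : Fin n, x i.succ • e i

/-- Being a paravector. -/
def IsParavector (a : Cl n) : Prop := ∃ x : Fin (n + 1) → ℝ, a = para x

/-- The coordinates in `ℝ^{n+1}` of (the paravector part of) a Clifford number. -/
def paraCoord (a : Cl n) : Fin (n + 1) → ℝ :=
  Fin.cases (coeff a ∅) (fun i => coeff a {i})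

/-- Being a (possibly empty) product of nonzero paravectors. -/
def IsProdOfParavectors (a : Cl n) : Prop :=
  ∃ l : List (Fin (n + 1) → ℝ), (∀ x ∈ l, x ≠ 0) ∧
    a = l.foldr (fun x b => mul (para x) b) one

/-- The special Ahlfors–Vahlen group `SAV(ℝ ⊕ ℝⁿ)`: 2×2 matrices `(a b; c d)` with entries
in `Cl n` such that each entry is `0` or a product of nonzero paravectors,
`a ⬝ reverse d - b ⬝ reverse c = 1`, and `a c⁻¹, c⁻¹ d` are paravectors if `c ≠ 0`
resp. `b d⁻¹` is a paravector if `c = 0`. -/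
structure SAV (n : ℕ) where
  a : Cl n
  b : Cl n
  c : Cl n
  d : Cl n
  prod_a : a = 0 ∨ IsProdOfParavectors a
  prod_b : b = 0 ∨ IsProdOfParavectors b
  prod_c : c = 0 ∨ IsProdOfParavectors c
  prod_d : d = 0 ∨ IsProdOfParavectors d
  det : mul a (reverse d) - mul b (reverse c) = one
  cond_c : c ≠ 0 → IsParavector (mul a (inv c)) ∧ IsParavector (mul (inv c) d)
  cond_c0 : c = 0 → IsParavector (mul b (inv d))

/-- The Clifford number `c x + d` attached to a matrix `M` and `x ∈ ℝ^{n+1}`. -/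
def cxd (M : SAV n) (x : Fin (n + 1) → ℝ) : Cl n := mul M.c (para x) + M.d

/-- The numerator `a x + b`. -/
def axb (M : SAV n) (x : Fin (n + 1) → ℝ) : Cl n := mul M.a (para x) + M.b

/-- The Möbius transformation `M<x> = (ax+b)(cx+d)⁻¹` as a Clifford number. -/
def moebiusCl (M : SAV n) (x : Fin (n + 1) → ℝ) : Cl n := mul (axb M x) (inv (cxd M x))

/-- The Möbius transformation `M<x>` as a point of `ℝ^{n+1}`. -/
def moebius (M : SAV n) (x : Fin (n + 1) → ℝ) : Fin (n + 1) → ℝ :=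
  paraCoord (moebiusCl M x)

/-- `a` lies in the subalgebra `Cl_{n-1}` generated by the `e j` with `j ≠ i`. -/
def memSub (a : Cl n) (i : Fin n) : Prop := ∀ A : Finset (Fin n), i ∈ A → coeff a A = 0

/-- The subgroup `SAV(ℝ ⊕ ℝ^{m})` of `SAV(ℝ ⊕ ℝ^{m+1})` of matrices whose entries lie
in the subalgebra `Cl_m ⊆ Cl_{m+1}`. -/
structure SAVsub (m : ℕ) extends SAV (m + 1) where
  sub_a : memSub a (Fin.last m)
  sub_b : memSub b (Fin.last m)
  sub_c : memSub c (Fin.last m)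
  sub_d : memSub d (Fin.last m)

/-- The `P`-part of `a ∈ Cl_{m+1} = Cl_m ⊕ Cl_m e_{top}`: `a = P a + (Q a) e_top`. -/
def Ppart {m : ℕ} (a : Cl (m + 1)) : Cl (m + 1) := fun A =>
  if Fin.last m ∈ A then 0 else a A

/-- The `Q`-part of `a ∈ Cl_{m+1} = Cl_m ⊕ Cl_m e_{top}`: `a = P a + (Q a) e_top`. -/
def Qpart {m : ℕ} (a : Cl (m + 1)) : Cl (m + 1) := fun A =>
  if Fin.last m ∈ A then 0 else a (insert (Fin.last m) A)

/-- Partial derivative `∂f/∂xᵢ`. -/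
def pderiv {E : Type*} [NormedAddCommGroup E] [NormedSpace ℝ E] {m : ℕ}
    (i : Fin m) (f : (Fin m → ℝ) → E) (x : Fin m → ℝ) : E :=
  fderiv ℝ f x (Pi.single i 1)

/-- The Euclidean Laplacian `Δ = Σᵢ ∂²/∂xᵢ²` (acting componentwise). -/
def lap {E : Type*} [NormedAddCommGroup E] [NormedSpace ℝ E] {m : ℕ}
    (f : (Fin m → ℝ) → E) : (Fin m → ℝ) → E :=
  fun x => ∑ i : Fin m, pderiv i (pderiv i f) x

/-- The Euclidean Dirac operator `D f = ∂f/∂x₀ + Σᵢ eᵢ ∂f/∂xᵢ`. -/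
def dirac (f : (Fin (n + 1) → ℝ) → Cl n) : (Fin (n + 1) → ℝ) → Cl n :=
  fun x => pderiv 0 f x + ∑ i : Fin n, mul (e i) (pderiv i.succ f x)

/-- Upper half-space `H⁺ = {x ∈ ℝ^{n+1} : xₙ > 0}`. -/
def upperHalf (n : ℕ) : Set (Fin (n + 1) → ℝ) := {x | 0 < x (Fin.last n)}

/-- The Euclidean norm on `ℝ^m`. -/
def enorm {m : ℕ} (x : Fin m → ℝ) : ℝ := Real.sqrt (∑ i, x i ^ 2)

end Cl

namespace Cl

variable {n : ℕ}

@[ext]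
lemma ext_coord {a b : Cl n} (h : ∀ A, a A = b A) : a = b := funext h

lemma zero_apply (A : Finset (Fin n)) : (0 : Cl n) A = 0 := rfl

lemma add_apply (a b : Cl n) (A : Finset (Fin n)) : (a + b) A = a A + b A := rfl

lemma smul_apply (r : ℝ) (a : Cl n) (A : Finset (Fin n)) : (r • a) A = r * a A := rfl

/-! ### The sign cocycle -/

lemma mulSign_eq_prod (A B : Finset (Fin n)) :
    mulSign A B = ∏ a ∈ A, ∏ b ∈ B, if b ≤ a then (-1 : ℝ) else 1 := by
  have h : ((A ×ˢ B).filter fun p => p.2 < p.1).card + (A ∩ B).card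
      = ((A ×ˢ B).filter fun p => p.2 ≤ p.1).card := by
    have hdiag : (A ∩ B).card = ((A ×ˢ B).filter fun p => p.2 = p.1).card := by
      refine Finset.card_bij (fun a _ => (a, a)) ?_ ?_ ?_
      · intro a ha
        simpa using ha
      · intro a _ b _ hab
        exact congrArg Prod.fst hab
      · rintro ⟨a, b⟩ hab
        simp only [Finset.mem_filter, Finset.mem_product] at hab
        obtain ⟨⟨ha, hb⟩, rfl⟩ := hab
        exact ⟨b, by simp [ha, hb], rfl⟩
    rw [hdiag, ← Finset.card_union_of_disjoint]
    · congr 1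
      ext p
      simp only [Finset.mem_union, Finset.mem_filter, le_iff_lt_or_eq]
      tauto
    · refine Finset.disjoint_filter.2 fun p _ h₁ h₂ => ?_
      exact h₁.ne h₂
  rw [mulSign, h, ← Finset.prod_product', Finset.prod_ite]
  simp

lemma prod_symmDiff {f : Fin n → ℝ} (hf : ∀ i, f i * f i = 1) (A B : Finset (Fin n)) :
    ∏ i ∈ A ∆ B, f i = (∏ i ∈ A, f i) * ∏ i ∈ B, f i := by
  have hA := Finset.prod_sdiff (f := f) (Finset.inter_subset_left (s₁ := A) (s₂ := B))
  have hB := Finset.prod_sdiff (f := f) (Finset.inter_subset_right (s₁ := A) (s₂ := B))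
  have hI : (∏ i ∈ A ∩ B, f i) * ∏ i ∈ A ∩ B, f i = 1 := by
    rw [← Finset.prod_mul_distrib]
    exact Finset.prod_eq_one fun i _ => hf i
  rw [Finset.sdiff_inter_self_left] at hA
  rw [Finset.sdiff_inter_self_right] at hB
  rw [symmDiff_def, Finset.sup_eq_union, Finset.prod_union disjoint_sdiff_sdiff, ← hA, ← hB]
  linear_combination (-(∏ i ∈ A \ B, f i) * ∏ i ∈ B \ A, f i) * hI

lemma mulSign_mul_self (A B : Finset (Fin n)) : mulSign A B * mulSign A B = 1 := by
  rw [mulSign, ← pow_add, ← two_mul]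
  simp

lemma mulSign_symmDiff_left (A B C : Finset (Fin n)) :
    mulSign (A ∆ B) C = mulSign A C * mulSign B C := by
  simp only [mulSign_eq_prod]
  refine prod_symmDiff (fun i => ?_) A B
  rw [← Finset.prod_mul_distrib]
  exact Finset.prod_eq_one fun j _ => by split_ifs <;> norm_num

lemma mulSign_symmDiff_right (A B C : Finset (Fin n)) :
    mulSign A (B ∆ C) = mulSign A B * mulSign A C := by
  simp only [mulSign_eq_prod]
  rw [← Finset.prod_mul_distrib]
  exact Finset.prod_congr rfl fun i _ =>
    prod_symmDiff (fun j => by split_ifs <;> norm_num) B C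

@[simp]
lemma mulSign_empty_left (A : Finset (Fin n)) : mulSign ∅ A = 1 := by simp [mulSign]

@[simp]
lemma mulSign_empty_right (A : Finset (Fin n)) : mulSign A ∅ = 1 := by simp [mulSign]

lemma mulSign_self (A : Finset (Fin n)) :
    mulSign A A = (-1 : ℝ) ^ (A.card * (A.card + 1) / 2) := by
  have hswap : ((A ×ˢ A).filter fun p => p.2 < p.1).card
      = ((A ×ˢ A).filter fun p => p.1 < p.2).card := by
    refine Finset.card_bij (fun p _ => p.swap) ?_ ?_ ?_
    · intro p hp
      simp only [Finset.mem_filter, Finset.mem_product] at hp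
      simp [hp]
    · intro p _ q _ hpq
      exact Prod.swap_injective hpq
    · intro p hp
      simp only [Finset.mem_filter, Finset.mem_product] at hp
      exact ⟨p.swap, by simp [hp], by simp⟩
  have hoff : ((A ×ˢ A).filter fun p => p.2 < p.1).card
      + ((A ×ˢ A).filter fun p => p.1 < p.2).card = A.offDiag.card := by
    rw [← Finset.card_union_of_disjoint]
    · congr 1
      ext p
      simp only [Finset.mem_union, Finset.mem_filter, Finset.mem_product, Finset.mem_offDiag,
        ne_iff_lt_or_gt]
      tauto
    · refine Finset.disjoint_filter.2 fun p _ h₁ h₂ => ?_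
      exact lt_asymm h₁ h₂
  rw [Finset.offDiag_card] at hoff
  rw [mulSign, Finset.inter_self]
  congr 1
  have hle : A.card ≤ A.card * A.card := Nat.le_mul_self _
  rw [mul_add, mul_one]
  omega

lemma triangle_exponent (c : ℕ) : c * (c + 1) / 2 = c * (c - 1) / 2 + c := by
  rw [← Nat.add_mul_div_right _ _ two_pos]
  congr 1
  cases c with
  | zero => rfl
  | succ c => rw [Nat.add_sub_cancel]; ring

lemma neg_one_pow_card_symmDiff (A B : Finset (Fin n)) :
    (-1 : ℝ) ^ (A ∆ B).card = (-1) ^ A.card * (-1) ^ B.card := by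
  simpa using prod_symmDiff (f := fun _ => (-1 : ℝ)) (by norm_num) A B

lemma conj_apply (a : Cl n) (A : Finset (Fin n)) : conj a A = mulSign A A * a A := by
  rw [conj, mulSign_self]

lemma reverse_apply (a : Cl n) (A : Finset (Fin n)) :
    reverse a A = (-1) ^ A.card * mulSign A A * a A := by
  have h : (-1 : ℝ) ^ A.card * (-1) ^ A.card = 1 := by rw [← pow_add, ← two_mul]; simp
  rw [reverse, mulSign_self, triangle_exponent, pow_add]
  linear_combination (-(-1) ^ (A.card * (A.card - 1) / 2) * a A) * h

lemma mulSign_singleton_left {i : Fin n} {A : Finset (Fin n)} (h : i ∉ A) :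
    mulSign {i} A = (-1) ^ A.card * mulSign A {i} := by
  simp only [mulSign_eq_prod, Finset.prod_singleton]
  rw [← Finset.prod_const, ← Finset.prod_mul_distrib]
  refine Finset.prod_congr rfl fun j hj => ?_
  have hne : j ≠ i := fun hji => h (hji ▸ hj)
  rcases lt_or_gt_of_ne hne with hlt | hlt
  · simp [hlt.le, hlt.not_ge]
  · simp [hlt.le, hlt.not_ge]

/-! ### The ring structure -/

lemma mul_apply (a b : Cl n) (C : Finset (Fin n)) :
    mul a b C = ∑ A, mulSign A (A ∆ C) * a A * b (A ∆ C) := by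
  refine Finset.sum_congr rfl fun A _ => ?_
  have h : ∀ B, A ∆ B = C ↔ B = A ∆ C := fun B =>
    ⟨fun h => by rw [← h, symmDiff_symmDiff_cancel_left],
      fun h => by rw [h, symmDiff_symmDiff_cancel_left]⟩
  simp [h]

/-- Translation by `A` in the group of finite sets under symmetric difference. -/
def symmDiffEquiv (A : Finset (Fin n)) : Finset (Fin n) ≃ Finset (Fin n) :=
  (symmDiff_right_involutive A).toPerm

lemma symmDiffEquiv_apply (A B : Finset (Fin n)) : symmDiffEquiv A B = A ∆ B := rfl

lemma mul_apply' (a b : Cl n) (C : Finset (Fin n)) :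
    mul a b C = ∑ B, mulSign (C ∆ B) B * a (C ∆ B) * b B := by
  rw [mul_apply, ← Equiv.sum_comp (symmDiffEquiv C)]
  refine Finset.sum_congr rfl fun B _ => ?_
  rw [symmDiffEquiv_apply, symmDiff_comm (C ∆ B) C, symmDiff_symmDiff_cancel_left]

lemma mul_mul_eq_mul_mul (a b c : Cl n) : mul (mul a b) c = mul a (mul b c) := by
  ext D
  simp only [mul_apply, Finset.mul_sum, Finset.sum_mul]
  rw [Finset.sum_comm]
  refine Finset.sum_congr rfl fun A _ => ?_
  rw [← Equiv.sum_comp (symmDiffEquiv A)]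
  refine Finset.sum_congr rfl fun G _ => ?_
  have hD : (A ∆ G) ∆ D = G ∆ (A ∆ D) := by rw [symmDiff_comm A G, symmDiff_assoc]
  rw [symmDiffEquiv_apply, symmDiff_symmDiff_cancel_left, hD]
  simp only [mulSign_symmDiff_left, mulSign_symmDiff_right]
  linear_combination (mulSign A A * mulSign A D * mulSign G G * mulSign G A * mulSign G D * a A
    * b G * c (G ∆ (A ∆ D))) * mulSign_mul_self A G

lemma one_apply (A : Finset (Fin n)) : (one : Cl n) A = if A = ∅ then 1 else 0 := by
  simp [one, Pi.single_apply]

lemma mul_smul_right (r : ℝ) (a b : Cl n) : mul a (r • b) = r • mul a b := by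
  ext C
  simp only [mul_apply, smul_apply, Finset.mul_sum]
  exact Finset.sum_congr rfl fun A _ => by ring

lemma zero_mul_left (a : Cl n) : mul 0 a = 0 := by
  ext C
  simp [mul_apply, zero_apply]

/-- The ring structure given by Clifford multiplication. -/
abbrev instRing : Ring (Cl n) :=
  { (inferInstance : AddCommGroup (Cl n)) with
    mul := mul
    one := one
    left_distrib := fun a b c => by
      change mul a (b + c) = mul a b + mul a c
      ext C
      simp only [mul_apply, add_apply, mul_add, Finset.sum_add_distrib]
    right_distrib := fun a b c => by
      change mul (a + b) c = mul a c + mul b c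
      ext C
      simp only [mul_apply, add_apply, mul_add, add_mul, Finset.sum_add_distrib]
    zero_mul := zero_mul_left
    mul_zero := fun a => by
      change mul a 0 = 0
      ext C
      simp [mul_apply, zero_apply]
    mul_assoc := mul_mul_eq_mul_mul
    one_mul := fun a => by
      change mul one a = a
      ext C
      simp [mul_apply, one_apply, ← Finset.bot_eq_empty, bot_symmDiff]
      simp
    mul_one := fun a => by
      change mul a one = a
      ext C
      simp [mul_apply', one_apply, ← Finset.bot_eq_empty, symmDiff_bot]
      simp }

attribute [local instance] instRing

lemma mul_eq (a b : Cl n) : mul a b = a * b := rfl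

lemma one_eq : (one : Cl n) = 1 := rfl

/-- The real algebra structure of the Clifford algebra. -/
abbrev instAlgebra : Algebra ℝ (Cl n) :=
  Algebra.ofModule
    (fun r a b => by
      rw [← mul_eq, ← mul_eq]
      ext C
      simp only [mul_apply, smul_apply, Finset.mul_sum]
      exact Finset.sum_congr rfl fun A _ => by ring)
    mul_smul_right

attribute [local instance] instAlgebra

lemma scalar_eq (r : ℝ) : (scalar r : Cl n) = r • 1 := by
  rw [← one_eq]
  ext A
  simp [smul_apply, one_apply, scalar, Pi.single_apply]

/-! ### Conjugation and reversion -/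

/-- Clifford conjugation as a linear map. -/
def conjₗ : Cl n →ₗ[ℝ] Cl n where
  toFun := conj
  map_add' a b := by ext A; simp only [conj_apply, add_apply]; ring
  map_smul' r a := by ext A; simp only [conj_apply, smul_apply, RingHom.id_apply]; ring

/-- Reversion as a linear map. -/
def reverseₗ : Cl n →ₗ[ℝ] Cl n where
  toFun := reverse
  map_add' a b := by ext A; simp only [reverse_apply, add_apply]; ring
  map_smul' r a := by ext A; simp only [reverse_apply, smul_apply, RingHom.id_apply]; ring

lemma conjₗ_apply (a : Cl n) : conjₗ a = conj a := rfl

lemma reverseₗ_apply (a : Cl n) : reverseₗ a = reverse a := rfl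

lemma conj_zero : conj (0 : Cl n) = 0 := map_zero conjₗ

lemma conj_mul (a b : Cl n) : conj (a * b) = conj b * conj a := by
  simp only [← mul_eq]
  ext C
  rw [conj_apply, mul_apply, mul_apply', Finset.mul_sum]
  refine Finset.sum_congr rfl fun A _ => ?_
  rw [conj_apply, conj_apply, symmDiff_comm C A]
  simp only [mulSign_symmDiff_left, mulSign_symmDiff_right]
  linear_combination (mulSign A A * mulSign A C * mulSign C C * a A * b (A ∆ C)) *
    (-(mulSign C A * mulSign C A) * mulSign_mul_self A A - mulSign_mul_self C A)

lemma reverse_mul (a b : Cl n) : reverse (a * b) = reverse b * reverse a := by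
  have h : ∀ (a : Cl n) (A : Finset (Fin n)), reverse a A = (-1) ^ A.card * conj a A :=
    fun a A => by rw [reverse_apply, conj_apply, mul_assoc]
  ext C
  rw [h, conj_mul, ← mul_eq, ← mul_eq, mul_apply, mul_apply, Finset.mul_sum]
  refine Finset.sum_congr rfl fun A _ => ?_
  rw [h, h]
  have hA : (-1 : ℝ) ^ A.card * (-1) ^ A.card = 1 := by rw [← pow_add, ← two_mul]; simp
  rw [neg_one_pow_card_symmDiff]
  linear_combination (-(-1) ^ C.card * mulSign A (A ∆ C) * conj b A * conj a (A ∆ C)) * hA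

lemma conj_one : conj (1 : Cl n) = 1 := by
  rw [← one_eq]
  ext A
  by_cases hA : A = ∅ <;> simp [conj_apply, one_apply, hA]

lemma reverse_one : reverse (1 : Cl n) = 1 := by
  rw [← one_eq]
  ext A
  by_cases hA : A = ∅ <;> simp [reverse_apply, one_apply, hA]

lemma e_apply (i : Fin n) (A : Finset (Fin n)) : e i A = if A = {i} then 1 else 0 := by
  simp [e, Pi.single_apply]

lemma conj_e (i : Fin n) : conj (e i) = -e i := by
  ext A
  change _ = -(e i A)
  by_cases hA : A = {i} <;> simp [conj_apply, e_apply, hA, mulSign_self]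

lemma reverse_e (i : Fin n) : reverse (e i) = e i := by
  ext A
  by_cases hA : A = {i} <;> simp [reverse_apply, e_apply, hA, mulSign_self]

/-! ### Generators and paravectors -/

lemma e_mul_apply (i : Fin n) (a : Cl n) (C : Finset (Fin n)) :
    (e i * a) C = mulSign {i} ({i} ∆ C) * a ({i} ∆ C) := by
  rw [← mul_eq, mul_apply]
  simp [e_apply]

lemma mul_e_apply (i : Fin n) (a : Cl n) (C : Finset (Fin n)) :
    (a * e i) C = mulSign ({i} ∆ C) {i} * a ({i} ∆ C) := by
  rw [← mul_eq, mul_apply']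
  simp [e_apply, symmDiff_comm]

lemma e_mul_self (i : Fin n) : e i * e i = -1 := by
  rw [← one_eq]
  ext C
  change _ = -(one C)
  rw [e_mul_apply, e_apply, one_apply]
  have h : ({i} : Finset (Fin n)) ∆ C = {i} ↔ C = ∅ := symmDiff_eq_left
  by_cases hC : C = ∅
  · subst hC
    rw [h.2 rfl, mulSign_self]
    simp
  · simp [h, hC]

lemma e_mul_conj {i : Fin n} {w : Cl n} (hw : memSub w i) :
    e i * conj w = reverse w * e i := by
  ext C
  rw [e_mul_apply, mul_e_apply, conj_apply, reverse_apply]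
  by_cases hi : i ∈ ({i} : Finset (Fin n)) ∆ C
  · have h0 : w ({i} ∆ C) = 0 := hw _ hi
    simp [h0]
  · rw [mulSign_singleton_left hi]
    ring

lemma memSub_e {i j : Fin n} (h : j ≠ i) : memSub (e j) i := by
  intro A hA
  change e j A = 0
  rw [e_apply, if_neg]
  rintro rfl
  exact h (Finset.mem_singleton.1 hA).symm

lemma e_anticomm {i j : Fin n} (h : i ≠ j) : e i * e j = -(e j * e i) := by
  have := e_mul_conj (memSub_e h.symm)
  rw [conj_e, reverse_e, mul_neg] at this
  rw [← this, neg_neg]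

/-- The subalgebra of elements not involving the generator `e i`. -/
def subAlg (i : Fin n) : Subalgebra ℝ (Cl n) where
  carrier := {a | memSub a i}
  add_mem' {a b} ha hb A hA := by
    change a A + b A = 0
    rw [show a A = 0 from ha A hA, show b A = 0 from hb A hA, add_zero]
  mul_mem' {a b} ha hb C hC := by
    change mul a b C = 0
    rw [mul_apply]
    refine Finset.sum_eq_zero fun A _ => ?_
    by_cases hA : i ∈ A
    · simp [show a A = 0 from ha A hA]
    · have : i ∈ A ∆ C := Finset.mem_symmDiff.2 (Or.inr ⟨hC, hA⟩)
      simp [show b (A ∆ C) = 0 from hb _ this]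
  algebraMap_mem' r A hA := by
    have hne : A ≠ ∅ := Finset.ne_empty_of_mem hA
    change algebraMap ℝ (Cl n) r A = 0
    rw [Algebra.algebraMap_eq_smul_one, ← one_eq, smul_apply, one_apply, if_neg hne, mul_zero]

lemma mem_subAlg {i : Fin n} {a : Cl n} : a ∈ subAlg i ↔ memSub a i := Iff.rfl

lemma conj_mem_subAlg {i : Fin n} {a : Cl n} (ha : a ∈ subAlg i) : conj a ∈ subAlg i := by
  intro A hA
  change conj a A = 0
  rw [conj_apply, show a A = 0 from ha A hA, mul_zero]

lemma para_eq (x : Fin (n + 1) → ℝ) : para x = x 0 • 1 + ∑ i : Fin n, x i.succ • e i := by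
  rw [para, scalar_eq]

lemma para_add (x y : Fin (n + 1) → ℝ) : para (x + y) = para x + para y := by
  simp only [para_eq, Pi.add_apply, add_smul, Finset.sum_add_distrib]
  abel

lemma conj_para (x : Fin (n + 1) → ℝ) :
    conj (para x) = x 0 • 1 - ∑ i : Fin n, x i.succ • e i := by
  rw [para_eq, ← conjₗ_apply]
  simp only [map_add, map_smul, map_sum]
  simp [conjₗ_apply, conj_one, conj_e, sub_eq_add_neg]

lemma vector_mul_self (v : Fin n → ℝ) :
    (∑ i, v i • e i) * (∑ i, v i • e i) = (-∑ i, v i ^ 2) • (1 : Cl n) := by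
  have hpair : ∀ i j, (v i • e i) * (v j • e j) + (v j • e j) * (v i • e i)
      = if i = j then (-2 * v i ^ 2) • (1 : Cl n) else 0 := by
    intro i j
    simp only [smul_mul_smul_comm]
    by_cases h : i = j
    · subst h
      rw [if_pos rfl, e_mul_self, smul_neg, ← neg_smul, ← add_smul]
      congr 1
      ring
    · rw [if_neg h, e_anticomm h, mul_comm (v j), smul_neg, neg_add_cancel]
  have htwo : (2 : ℝ) • ((∑ i, v i • e i) * (∑ i, v i • e i))
      = (2 : ℝ) • ((-∑ i, v i ^ 2) • (1 : Cl n)) := by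
    rw [two_smul]
    conv_lhs => rw [Finset.sum_mul_sum]; arg 2; rw [Finset.sum_comm]
    simp only [← Finset.sum_add_distrib, hpair]
    simp only [Finset.sum_ite_eq, Finset.mem_univ, if_true]
    rw [← Finset.sum_smul, smul_smul, ← Finset.mul_sum]
    congr 1
    ring
  exact smul_right_injective _ (two_ne_zero (α := ℝ)) htwo

/-! ### Multiplicative elements -/

/-- `conj a * a` and `a * conj a` are equal to the same real scalar. -/
def HasScalarNorm (a : Cl n) : Prop :=
  ∃ r : ℝ, conj a * a = r • 1 ∧ a * conj a = r • 1

lemma HasScalarNorm.mul {a b : Cl n} (ha : HasScalarNorm a) (hb : HasScalarNorm b) :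
    HasScalarNorm (a * b) := by
  obtain ⟨r, hr, hr'⟩ := ha
  obtain ⟨s, hs, hs'⟩ := hb
  refine ⟨r * s, ?_, ?_⟩
  · rw [conj_mul, mul_assoc, ← mul_assoc (conj a), hr, smul_mul_assoc, one_mul, mul_smul_comm, hs,
      smul_smul]
  · rw [conj_mul, mul_assoc, ← mul_assoc b, hs', smul_mul_assoc, one_mul, mul_smul_comm, hr',
      smul_smul, mul_comm]

lemma hasScalarNorm_one : HasScalarNorm (1 : Cl n) := ⟨1, by simp [conj_one], by simp [conj_one]⟩

lemma hasScalarNorm_zero : HasScalarNorm (0 : Cl n) := ⟨0, by simp, by simp⟩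

lemma hasScalarNorm_para (x : Fin (n + 1) → ℝ) : HasScalarNorm (para x) := by
  refine ⟨x 0 ^ 2 + ∑ i : Fin n, x i.succ ^ 2, ?_, ?_⟩ <;>
  · rw [conj_para, para_eq]
    have h := vector_mul_self fun i : Fin n => x i.succ
    simp only [mul_add, add_mul, mul_sub, sub_mul, smul_mul_assoc, one_mul, mul_smul_comm, mul_one,
      h]
    module

lemma IsProdOfParavectors.hasScalarNorm {a : Cl n} (ha : IsProdOfParavectors a) :
    HasScalarNorm a := by
  obtain ⟨l, -, rfl⟩ := ha
  induction l with
  | nil => exact hasScalarNorm_one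
  | cons x l ih => exact (hasScalarNorm_para x).mul ih

lemma hasScalarNorm_of_zero_or_prod {a : Cl n} (ha : a = 0 ∨ IsProdOfParavectors a) :
    HasScalarNorm a :=
  ha.elim (fun h => h ▸ hasScalarNorm_zero) IsProdOfParavectors.hasScalarNorm

lemma norm_sq (a : Cl n) : Cl.norm a ^ 2 = ∑ A, a A ^ 2 :=
  Real.sq_sqrt (Finset.sum_nonneg fun _ _ => sq_nonneg _)

lemma norm_ne_zero {a : Cl n} (ha : a ≠ 0) : Cl.norm a ≠ 0 := by
  intro h
  refine ha (ext_coord fun A => ?_)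
  have hs := norm_sq a
  rw [h, zero_pow two_ne_zero] at hs
  have hz := (Finset.sum_eq_zero_iff_of_nonneg fun _ _ => sq_nonneg _).1 hs.symm
  exact (pow_eq_zero_iff two_ne_zero).1 (hz A (Finset.mem_univ A))

lemma conj_mul_self_apply_empty (a : Cl n) : (conj a * a) ∅ = Cl.norm a ^ 2 := by
  rw [norm_sq, ← mul_eq, mul_apply]
  refine Finset.sum_congr rfl fun A _ => ?_
  rw [← Finset.bot_eq_empty, symmDiff_bot, conj_apply]
  linear_combination (a A ^ 2) * mulSign_mul_self A A

lemma HasScalarNorm.conj_mul_self {a : Cl n} (ha : HasScalarNorm a) :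
    conj a * a = Cl.norm a ^ 2 • 1 ∧ a * conj a = Cl.norm a ^ 2 • 1 := by
  obtain ⟨r, hr, hr'⟩ := ha
  have h : Cl.norm a ^ 2 = r := by
    rw [← conj_mul_self_apply_empty, hr, ← one_eq, smul_apply, one_apply, if_pos rfl, mul_one]
  rw [h]
  exact ⟨hr, hr'⟩

lemma HasScalarNorm.inv_spec {a : Cl n} (ha : HasScalarNorm a) (h0 : a ≠ 0) :
    a * inv a = 1 ∧ inv a = (Cl.norm a ^ 2)⁻¹ • conj a := by
  obtain ⟨h₁, h₂⟩ := ha.conj_mul_self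
  have hN : Cl.norm a ^ 2 ≠ 0 := pow_ne_zero 2 (norm_ne_zero h0)
  have hl : ((Cl.norm a ^ 2)⁻¹ • conj a) * a = 1 := by
    rw [smul_mul_assoc, h₁, smul_smul, inv_mul_cancel₀ hN, one_smul]
  have hr : a * ((Cl.norm a ^ 2)⁻¹ • conj a) = 1 := by
    rw [mul_smul_comm, h₂, smul_smul, inv_mul_cancel₀ hN, one_smul]
  have hinv : IsInvertible a := ⟨_, hr, hl⟩
  have hi : a * inv a = 1 := by
    rw [inv, dif_pos hinv]
    exact hinv.choose_spec.1
  exact ⟨hi, (left_inv_eq_right_inv hl hi).symm⟩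

/-! ### The action on the last coordinate -/

lemma hasScalarNorm_cxd (M : SAV n) (x : Fin (n + 1) → ℝ) : HasScalarNorm (cxd M x) := by
  have hc := hasScalarNorm_of_zero_or_prod M.prod_c
  by_cases h : M.c = 0
  · rw [cxd, h, mul_eq, zero_mul, zero_add]
    exact hasScalarNorm_of_zero_or_prod M.prod_d
  · obtain ⟨y, hy⟩ := (M.cond_c h).2
    have : cxd M x = M.c * para (x + y) := by
      rw [cxd, para_add, ← hy, mul_eq, mul_eq, mul_add, ← mul_assoc, (hc.inv_spec h).1, one_mul]
    rw [this]
    exact hc.mul (hasScalarNorm_para _)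

lemma exists_para_decomp {m : ℕ} (x : Fin (m + 2) → ℝ) :
    ∃ p ∈ subAlg (Fin.last m), reverse p = p ∧
      para x = p + x (Fin.last (m + 1)) • e (Fin.last m) := by
  refine ⟨x 0 • 1 + ∑ i : Fin m, x i.castSucc.succ • e i.castSucc, ?_, ?_, ?_⟩
  · refine add_mem ((subAlg _).smul_mem (one_mem _) _) (sum_mem fun i _ => ?_)
    exact (subAlg _).smul_mem (mem_subAlg.2 (memSub_e (Fin.castSucc_lt_last i).ne)) _
  · rw [← reverseₗ_apply]
    simp only [map_add, map_smul, map_sum]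
    simp only [reverseₗ_apply, reverse_one, reverse_e]
  · rw [para_eq, Fin.sum_univ_castSucc]
    exact (add_assoc _ _ _).symm

lemma axb_mul_conj_cxd_apply_last {m : ℕ} (M : SAVsub m) (x : Fin (m + 2) → ℝ) :
    (axb M.toSAV x * conj (cxd M.toSAV x)) {Fin.last m} = x (Fin.last (m + 1)) := by
  obtain ⟨p, hp, hrev, hx⟩ := exists_para_decomp x
  set t := x (Fin.last (m + 1))
  set i := Fin.last m
  have ha : M.a ∈ subAlg i := M.sub_a
  have hb : M.b ∈ subAlg i := M.sub_b
  have hc : M.c ∈ subAlg i := M.sub_c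
  have hd : M.d ∈ subAlg i := M.sub_d
  have hw : M.c * p + M.d ∈ subAlg i := add_mem (mul_mem hc hp) hd
  have hax : axb M.toSAV x = (M.a * p + M.b) + t • (M.a * e i) := by
    rw [axb, hx, mul_eq, mul_add, mul_smul_comm]
    abel
  have hcx : conj (cxd M.toSAV x) = conj (M.c * p + M.d) - t • (e i * conj M.c) := by
    have : cxd M.toSAV x = (M.c * p + M.d) + t • (M.c * e i) := by
      rw [cxd, hx, mul_eq, mul_add, mul_smul_comm]
      abel
    rw [this, ← conjₗ_apply, map_add, map_smul]
    simp only [conjₗ_apply, conj_mul M.c (e i), conj_e, neg_mul, smul_neg, sub_eq_add_neg]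
  have hdet : M.a * reverse M.d - M.b * reverse M.c = 1 := M.det
  have hrevw : reverse (M.c * p + M.d) = p * reverse M.c + reverse M.d := by
    rw [← reverseₗ_apply, map_add, reverseₗ_apply, reverseₗ_apply, reverse_mul, hrev]
  have hprod : axb M.toSAV x * conj (cxd M.toSAV x)
      = ((M.a * p + M.b) * conj (M.c * p + M.d) + (t * t) • (M.a * conj M.c)) + t • e i := by
    have h₁ : M.a * e i * conj (M.c * p + M.d)
        = (M.a * p * reverse M.c + M.a * reverse M.d) * e i := by
      rw [mul_assoc, e_mul_conj hw, hrevw]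
      noncomm_ring
    have h₂ : (M.a * p + M.b) * (e i * conj M.c)
        = (M.a * p * reverse M.c + M.b * reverse M.c) * e i := by
      rw [e_mul_conj hc]
      noncomm_ring
    have h₃ : M.a * e i * (e i * conj M.c) = -(M.a * conj M.c) := by
      rw [mul_assoc, ← mul_assoc (e i), e_mul_self]
      noncomm_ring
    have h₄ : (M.a * p * reverse M.c + M.a * reverse M.d) * e i
        - (M.a * p * reverse M.c + M.b * reverse M.c) * e i = e i := by
      rw [← sub_mul, add_sub_add_left_eq_sub, hdet, one_mul]
    rw [hax, hcx, add_mul, mul_sub, mul_sub, mul_smul_comm, smul_mul_assoc, smul_mul_smul_comm,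
      h₁, h₂, h₃]
    nth_rewrite 3 [← h₄]
    module
  have hmem : (M.a * p + M.b) * conj (M.c * p + M.d) + (t * t) • (M.a * conj M.c) ∈ subAlg i :=
    add_mem (mul_mem (add_mem (mul_mem ha hp) hb) (conj_mem_subAlg hw))
      ((subAlg i).smul_mem (mul_mem ha (conj_mem_subAlg hc)) _)
  have h0 := hmem {i} (Finset.mem_singleton_self i)
  rw [coeff] at h0
  rw [hprod, add_apply, h0, smul_apply, e_apply, if_pos rfl, zero_add, mul_one]

lemma moebius_last {m : ℕ} (M : SAVsub m) (x : Fin (m + 2) → ℝ) (h : cxd M.toSAV x ≠ 0) :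
    moebius M.toSAV x (Fin.last (m + 1))
      = (Cl.norm (cxd M.toSAV x) ^ 2)⁻¹ * x (Fin.last (m + 1)) := by
  rw [moebius, ← Fin.succ_last]
  change moebiusCl M.toSAV x {Fin.last m} = _
  rw [moebiusCl, mul_eq, ((hasScalarNorm_cxd _ _).inv_spec h).2, mul_smul_comm, smul_apply,
    axb_mul_conj_cxd_apply_last, Fin.succ_last]

end Cl

/-- Proposition 1: if `f` is an automorphic form of weight factor
`conj(cx+d)/‖cx+d‖^{n+1-k}`, then `g = xₙ^{-k} f` transforms with the weight factor
`conj(cx+d)/‖cx+d‖^{n+1+k}`.  Here `n = m + 2 ≥ 2`. -/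
theorem weight_change_by_power_scaling
    (m : ℕ) (k : ℤ) (hk : Even k)
    (M : Cl.SAVsub (m + 1))
    (f : (Fin (m + 3) → ℝ) → Cl (m + 2))
    (hf : ∀ x ∈ Cl.upperHalf (m + 2),
      f x = (Cl.norm (Cl.cxd M.toSAV x) ^ (((m : ℤ) + 2) + 1 - k))⁻¹ •
        Cl.mul (Cl.conj (Cl.cxd M.toSAV x)) (f (Cl.moebius M.toSAV x)))
    (g : (Fin (m + 3) → ℝ) → Cl (m + 2))
    (hg : g = fun y => (y (Fin.last (m + 2)) ^ (-k)) • f y) :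
    ∀ x ∈ Cl.upperHalf (m + 2),
      g x = (Cl.norm (Cl.cxd M.toSAV x) ^ (((m : ℤ) + 2) + 1 + k))⁻¹ •
        Cl.mul (Cl.conj (Cl.cxd M.toSAV x)) (g (Cl.moebius M.toSAV x)) := by
  intro x hx
  subst hg
  have hx0 := hf x hx
  by_cases h : Cl.cxd M.toSAV x = 0
  · simp only [h, Cl.conj_zero, Cl.zero_mul_left, smul_zero] at hx0 ⊢
    rw [hx0, smul_zero]
  · have hN := Cl.norm_ne_zero h
    beta_reduce
    rw [Cl.moebius_last M x h, hx0]
    simp only [Cl.mul_smul_right, smul_smul]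
    congr 1
    rw [mul_zpow, inv_zpow, zpow_neg (_ ^ 2), inv_inv, ← zpow_natCast, ← zpow_mul,
      ← mul_assoc, mul_comm (x _ ^ _), ← zpow_neg, ← zpow_neg, ← zpow_add₀ hN]
    congr 2
    push_cast
    ring
end
end

section
/- Let n ≥ 1 and k ∈ ℝ. If u : H⁺ → ℝ is a smooth solution of the k-hyperbolic harmonic equation x_n Δu − k ∂u/∂x_n = 0 on H⁺, then g(x) := x_n^{−(1−n+k)/2} u(x) (real power of x_n > 0) satisfies Δg − ((n−1)/x_n) ∂g/∂x_n + λ g/x_n² = 0 on H⁺, where λ = (n² − (k+1)²)/4; equivalently, g is an eigenfunction of the Laplace–Beltrami operator x_n²Δ − (n−1)x_n ∂/∂x_n with eigenvalue −(n² − (k+1)²)/4. -/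
noncomputable section

open scoped symmDiff

open Topology in
theorem Cl.upperHalf_mem_nhds {n : ℕ} {x : Fin (n + 1) → ℝ} (hx : x ∈ Cl.upperHalf n) :
    Cl.upperHalf n ∈ 𝓝 x :=
  (isOpen_lt continuous_const (continuous_apply (Fin.last n))).mem_nhds hx

/-- Product rule for the partial derivatives of `y ↦ yₙ ^ a * f y` on the upper half-space. -/
theorem Cl.hasFDerivAt_rpow_last_mul {n : ℕ} {x : Fin (n + 1) → ℝ} (hx : x ∈ Cl.upperHalf n)
    (a : ℝ) {f : (Fin (n + 1) → ℝ) → ℝ} (hf : DifferentiableAt ℝ f x) :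
    HasFDerivAt (fun y => y (Fin.last n) ^ a * f y)
      (x (Fin.last n) ^ a • fderiv ℝ f x + f x • (a * x (Fin.last n) ^ (a - 1)) •
        ContinuousLinearMap.proj (R := ℝ) (φ := fun _ : Fin (n + 1) => ℝ) (Fin.last n)) x :=
  ((hasFDerivAt_apply (Fin.last n) x).rpow_const (Or.inl (ne_of_gt hx))).mul hf.hasFDerivAt

theorem Cl.pderiv_rpow_last_mul {n : ℕ} {x : Fin (n + 1) → ℝ} (hx : x ∈ Cl.upperHalf n)
    (a : ℝ) {f : (Fin (n + 1) → ℝ) → ℝ} (hf : DifferentiableAt ℝ f x) (i : Fin (n + 1)) :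
    Cl.pderiv i (fun y => y (Fin.last n) ^ a * f y) x =
      x (Fin.last n) ^ a * Cl.pderiv i f x +
        (if i = Fin.last n then a else 0) * (x (Fin.last n) ^ (a - 1) * f x) := by
  rw [Cl.pderiv, (Cl.hasFDerivAt_rpow_last_mul hx a hf).fderiv]
  by_cases h : i = Fin.last n
  · subst h
    simp [Cl.pderiv]
    ring
  · simp [Cl.pderiv, h, Ne.symm h]

/-- Second partial derivatives of `y ↦ yₙ ^ a * f y` on the upper half-space. -/
theorem Cl.pderiv_pderiv_rpow_last_mul {n : ℕ} {x : Fin (n + 1) → ℝ}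
    (hx : x ∈ Cl.upperHalf n) (a : ℝ) {f : (Fin (n + 1) → ℝ) → ℝ}
    (hf : ContDiffOn ℝ 2 f (Cl.upperHalf n)) (i : Fin (n + 1)) :
    Cl.pderiv i (Cl.pderiv i (fun y => y (Fin.last n) ^ a * f y)) x =
      x (Fin.last n) ^ a * Cl.pderiv i (Cl.pderiv i f) x +
        if i = Fin.last n then
          2 * a * x (Fin.last n) ^ (a - 1) * Cl.pderiv (Fin.last n) f x +
            a * (a - 1) * x (Fin.last n) ^ (a - 2) * f x
        else 0 := by
  have hfd : ∀ y ∈ Cl.upperHalf n, DifferentiableAt ℝ f y := fun y hy =>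
    (hf.contDiffAt (Cl.upperHalf_mem_nhds hy)).differentiableAt (by norm_num)
  have hpd : DifferentiableAt ℝ (Cl.pderiv i f) x :=
    (((hf.contDiffAt (Cl.upperHalf_mem_nhds hx)).fderiv_right
      (m := 1) (by norm_num)).differentiableAt (by norm_num)).clm_apply
      (differentiableAt_const _)
  have hev := Filter.eventuallyEq_of_mem (Cl.upperHalf_mem_nhds hx)
    fun y hy => Cl.pderiv_rpow_last_mul hy a (hfd y hy) i
  have h₁ := (Cl.hasFDerivAt_rpow_last_mul hx a hpd).differentiableAt
  have h₂ := (Cl.hasFDerivAt_rpow_last_mul hx (a - 1) (hfd x hx)).differentiableAt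
  have hsplit : Cl.pderiv i (Cl.pderiv i (fun y => y (Fin.last n) ^ a * f y)) x =
      Cl.pderiv i (fun y => y (Fin.last n) ^ a * Cl.pderiv i f y) x +
        (if i = Fin.last n then a else 0) *
          Cl.pderiv i (fun y => y (Fin.last n) ^ (a - 1) * f y) x := by
    rw [Cl.pderiv, hev.fderiv_eq, fderiv_fun_add h₁ (h₂.const_mul _), fderiv_const_mul h₂]
    rfl
  rw [hsplit, Cl.pderiv_rpow_last_mul hx a hpd, Cl.pderiv_rpow_last_mul hx (a - 1) (hfd x hx)]
  split_ifs with h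
  · subst h
    rw [show a - 1 - 1 = a - 2 by ring]
    ring
  · ring

/-- The Laplacian of `y ↦ yₙ ^ a * f y` on the upper half-space. -/
theorem Cl.lap_rpow_last_mul {n : ℕ} {x : Fin (n + 1) → ℝ}
    (hx : x ∈ Cl.upperHalf n) (a : ℝ) {f : (Fin (n + 1) → ℝ) → ℝ}
    (hf : ContDiffOn ℝ 2 f (Cl.upperHalf n)) :
    Cl.lap (fun y => y (Fin.last n) ^ a * f y) x =
      x (Fin.last n) ^ a * Cl.lap f x +
        2 * a * x (Fin.last n) ^ (a - 1) * Cl.pderiv (Fin.last n) f x +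
        a * (a - 1) * x (Fin.last n) ^ (a - 2) * f x := by
  simp only [Cl.lap, Cl.pderiv_pderiv_rpow_last_mul hx a hf, Finset.sum_add_distrib,
    Finset.mul_sum, Finset.sum_ite_eq', Finset.mem_univ, if_true, add_assoc]

/-- If `u` is `k`-hyperbolic harmonic (`xₙ Δu - k ∂u/∂xₙ = 0`) on `H⁺`, then
`g = xₙ^{-(1-n+k)/2} u` solves the Maaß wave equation
`Δg - ((n-1)/xₙ) ∂g/∂xₙ + λ g/xₙ² = 0` with `λ = (n² - (k+1)²)/4`; equivalently `g` is an
eigenfunction of `xₙ²Δ - (n-1)xₙ ∂/∂xₙ` with eigenvalue `-(n² - (k+1)²)/4`. -/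
theorem k_hyperbolic_harmonic_gives_maass_solution
    (n : ℕ) (hn : 1 ≤ n) (k : ℝ)
    (u : (Fin (n + 1) → ℝ) → ℝ)
    (hu : ContDiffOn ℝ (⊤ : ℕ∞) u (Cl.upperHalf n))
    (heq : ∀ x ∈ Cl.upperHalf n,
      x (Fin.last n) * Cl.lap u x - k * Cl.pderiv (Fin.last n) u x = 0)
    (g : (Fin (n + 1) → ℝ) → ℝ)
    (hg : g = fun y => y (Fin.last n) ^ (-(1 - (n : ℝ) + k) / 2) * u y) :
    ∀ x ∈ Cl.upperHalf n,
      (Cl.lap g x - ((n : ℝ) - 1) / x (Fin.last n) * Cl.pderiv (Fin.last n) g x +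
          (((n : ℝ) ^ 2 - (k + 1) ^ 2) / 4) * g x / x (Fin.last n) ^ 2 = 0) ∧
      (x (Fin.last n) ^ 2 * Cl.lap g x -
          ((n : ℝ) - 1) * x (Fin.last n) * Cl.pderiv (Fin.last n) g x =
        -(((n : ℝ) ^ 2 - (k + 1) ^ 2) / 4) * g x) := by
  intro x hx
  have hpos : 0 < x (Fin.last n) := hx
  have hne := hpos.ne'
  have hu₂ : ContDiffOn ℝ 2 u (Cl.upperHalf n) := contDiffOn_infty.1 hu 2
  have hud : DifferentiableAt ℝ u x :=
    (hu₂.contDiffAt (Cl.upperHalf_mem_nhds hx)).differentiableAt (by norm_num)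
  have hlap : Cl.lap u x = k * Cl.pderiv (Fin.last n) u x / x (Fin.last n) := by
    rw [eq_div_iff hne]
    linarith [heq x hx]
  have key : x (Fin.last n) ^ 2 * Cl.lap g x -
      ((n : ℝ) - 1) * x (Fin.last n) * Cl.pderiv (Fin.last n) g x =
        -(((n : ℝ) ^ 2 - (k + 1) ^ 2) / 4) * g x := by
    rw [hg, Cl.lap_rpow_last_mul hx _ hu₂, Cl.pderiv_rpow_last_mul hx _ hud, if_pos rfl, hlap,
      Real.rpow_sub_one hne, Real.rpow_sub hpos _ 2,
      Real.rpow_two]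
    field_simp
    ring
  refine ⟨?_, key⟩
  field_simp
  linear_combination 4 * key
end
end
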